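/- arXiv:2310.12468 — 5 statements merged into one kernel-verified Lean document; each statement's English description precedes it below -/
import Mathlib

section
/- Let (x_k)_{k≥1} be a sequence of nonzero integers with x_k x_{k+1} < 0 for all k, and set ε = sign(x₁). Let p_j, q_j be the convergent numerators and denominators associated to the digit sequence a_j = |x_j|. Then for every k ≥ 1 the product S T^{x₁} S T^{x₂} ⋯ S T^{x_k} in SL₂(ℤ) equals, up to an overall sign ±1 (i.e., equals in PSL₂(ℤ)), the matrix [[−ε p_{k−1}, (−1)^k p_k], [q_{k−1}, (−1)^{k+1} ε q_k]]. -/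
open Matrix MatrixGroups

/-- Convergent numerators: `pp a (k+1) = p_k` where `p_{-1} = 1`, `p_0 = 0`,
`p_k = a_k p_{k-1} + p_{k-2}`. -/
def pp (a : ℕ → ℤ) : ℕ → ℤ
  | 0 => 1
  | 1 => 0
  | k + 2 => a (k + 1) * pp a (k + 1) + pp a k

/-- Convergent denominators: `qq a (k+1) = q_k` where `q_{-1} = 0`, `q_0 = 1`,
`q_k = a_k q_{k-1} + q_{k-2}`. -/
def qq (a : ℕ → ℤ) : ℕ → ℤ
  | 0 => 0
  | 1 => 1
  | k + 2 => a (k + 1) * qq a (k + 1) + qq a k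

/-- A sequence of integers with alternating signs is determined by its first sign and
its absolute values. -/
theorem eq_neg_one_pow_mul_sign_mul_abs {x : ℕ → ℤ}
    (halt : ∀ k, 1 ≤ k → x k * x (k + 1) < 0) (k : ℕ) :
    x (k + 1) = (-1) ^ k * Int.sign (x 1) * |x (k + 1)| := by
  have hsign : Int.sign (x (k + 1)) = (-1) ^ k * Int.sign (x 1) := by
    induction k with
    | zero => simp
    | succ k ih =>
      have hstep : Int.sign (x (k + 1 + 1)) = -Int.sign (x (k + 1)) := by
        rcases mul_neg_iff.mp (halt (k + 1) k.succ_pos) with ⟨h₁, h₂⟩ | ⟨h₁, h₂⟩ <;>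
          simp [Int.sign_eq_one_of_pos, Int.sign_eq_neg_one_of_neg, h₁, h₂]
      rw [hstep, ih, pow_succ]
      ring
  rw [← hsign, Int.sign_mul_abs]

theorem coe_S_mul_T_zpow (n : ℤ) :
    (↑(ModularGroup.S * ModularGroup.T ^ n) : Matrix (Fin 2) (Fin 2) ℤ) = !![0, -1; 1, n] := by
  simp [ModularGroup.coe_S, ModularGroup.coe_T_zpow]

/-- The product `S T^{x₁} ⋯ S T^{x_k}` in terms of convergents, up to sign, when
`x_{k+1} = (-1)^k ε a_{k+1}` with `ε = ±1`. -/
theorem prod_S_mul_T_zpow_eq_or_neg {x a : ℕ → ℤ} {ε : ℤ} (hε : ε * ε = 1)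
    (hxa : ∀ k, x (k + 1) = (-1) ^ k * ε * a (k + 1)) (k : ℕ) :
    (↑(((List.range k).map (fun j => ModularGroup.S * ModularGroup.T ^ (x (j + 1)))).prod) :
        Matrix (Fin 2) (Fin 2) ℤ)
        = !![-ε * pp a k, (-1) ^ k * pp a (k + 1); qq a k, (-1) ^ (k + 1) * ε * qq a (k + 1)] ∨
    (↑(((List.range k).map (fun j => ModularGroup.S * ModularGroup.T ^ (x (j + 1)))).prod) :
        Matrix (Fin 2) (Fin 2) ℤ)
        = -!![-ε * pp a k, (-1) ^ k * pp a (k + 1);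
            qq a k, (-1) ^ (k + 1) * ε * qq a (k + 1)] := by
  induction k with
  | zero =>
    rcases mul_self_eq_one_iff.mp hε with rfl | rfl
    · right
      simp [pp, qq, Matrix.one_fin_two]
    · left
      simp [pp, qq, Matrix.one_fin_two]
  | succ k ih =>
    have hstep :
        !![-ε * pp a k, (-1) ^ k * pp a (k + 1); qq a k, (-1) ^ (k + 1) * ε * qq a (k + 1)] *
          !![0, -1; 1, x (k + 1)] =
        ((-1) ^ (k + 1) * ε) • !![-ε * pp a (k + 1), (-1) ^ (k + 1) * pp a (k + 1 + 1);
          qq a (k + 1), (-1) ^ (k + 1 + 1) * ε * qq a (k + 1 + 1)] := by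
      rw [hxa]
      rcases mul_self_eq_one_iff.mp hε with rfl | rfl <;>
        rcases neg_one_pow_eq_or ℤ k with hk | hk <;>
        ext i j <;> fin_cases i <;> fin_cases j <;>
        simp [pp, qq, pow_succ, hk] <;> ring
    have hsign : ((-1) ^ (k + 1) * ε) = 1 ∨ ((-1) ^ (k + 1) * ε) = -1 := by
      rcases mul_self_eq_one_iff.mp hε with rfl | rfl <;>
        rcases neg_one_pow_eq_or ℤ (k + 1) with hk | hk <;> simp [hk]
    rw [List.range_succ, List.map_append, List.prod_append, List.map_singleton,
      List.prod_singleton, Matrix.SpecialLinearGroup.coe_mul, coe_S_mul_T_zpow]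
    rcases ih with h | h <;> rcases hsign with hs | hs <;>
      simp only [h, Matrix.neg_mul, hstep] <;> rw [hs] <;> simp only [one_smul, neg_smul, neg_neg,
        true_or, or_true]

/-- Let `(x_k)_{k≥1}` be a sequence of nonzero integers with `x_k x_{k+1} < 0` for all `k`,
and set `ε = sign x₁`.  Let `p_j, q_j` be the convergents associated to the digits
`a_j = |x_j|`.  Then for every `k ≥ 1` the product `S T^{x₁} S T^{x₂} ⋯ S T^{x_k}` in
`SL₂(ℤ)` equals, up to an overall sign `±1` (i.e. equals in `PSL₂(ℤ)`), the matrix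
`[[-ε p_{k-1}, (-1)^k p_k], [q_{k-1}, (-1)^{k+1} ε q_k]]`. -/
theorem statement1 (x : ℕ → ℤ) (hx : ∀ k, 1 ≤ k → x k ≠ 0)
    (halt : ∀ k, 1 ≤ k → x k * x (k + 1) < 0) (k : ℕ) (hk : 1 ≤ k) :
    (↑(((List.range k).map (fun j => ModularGroup.S * ModularGroup.T ^ (x (j + 1)))).prod) :
        Matrix (Fin 2) (Fin 2) ℤ)
        = !![-(Int.sign (x 1)) * pp (fun j => |x j|) k,
              (-1) ^ k * pp (fun j => |x j|) (k + 1);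
            qq (fun j => |x j|) k,
              (-1) ^ (k + 1) * Int.sign (x 1) * qq (fun j => |x j|) (k + 1)] ∨
    (↑(((List.range k).map (fun j => ModularGroup.S * ModularGroup.T ^ (x (j + 1)))).prod) :
        Matrix (Fin 2) (Fin 2) ℤ)
        = -!![-(Int.sign (x 1)) * pp (fun j => |x j|) k,
              (-1) ^ k * pp (fun j => |x j|) (k + 1);
            qq (fun j => |x j|) k,
              (-1) ^ (k + 1) * Int.sign (x 1) * qq (fun j => |x j|) (k + 1)] := by
  have hsq : Int.sign (x 1) * Int.sign (x 1) = 1 := by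
    rw [← Int.sign_mul, Int.sign_eq_one_of_pos (mul_self_pos.mpr (hx 1 le_rfl))]
  exact prod_S_mul_T_zpow_eq_or_neg (a := fun j => |x j|) hsq
    (eq_neg_one_pow_mul_sign_mul_abs halt) k
end

section
/- Let (x_k)_{k≥1} be a sequence of nonzero integers with x_k x_{k+1} < 0 for all k, set ε = sign(x₁), and let p_j, q_j be the convergent numerators and denominators associated to the digits a_j = |x_j|. Then for every k ≥ 1 the Möbius transformation of ℝ ∪ {∞} given by the matrix S T^{x₁} S T^{x₂} ⋯ S T^{x_k} maps ∞ to −ε · p_{k−1}/q_{k−1} and maps 0 to −ε · p_k/q_k. -/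
/-- The matrix `S = [[0,-1],[1,0]]`. -/
def Smat : Matrix (Fin 2) (Fin 2) ℤ := !![0, -1; 1, 0]

/-- The matrix `T^x = [[1,x],[0,1]]`, the `x`-th power of `T = [[1,1],[0,1]]`. -/
def Tpow (x : ℤ) : Matrix (Fin 2) (Fin 2) ℤ := !![1, x; 0, 1]

/-- The Möbius action of an integer matrix `[[a,b],[c,d]]` on `ℝ ∪ {∞}`,
`z ↦ (az+b)/(cz+d)`. -/
noncomputable def mob (g : Matrix (Fin 2) (Fin 2) ℤ) : OnePoint ℝ → OnePoint ℝ := fun z =>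
  match z with
  | OnePoint.infty =>
      if (g 1 0 : ℝ) = 0 then OnePoint.infty
      else ((g 0 0 : ℝ) / (g 1 0 : ℝ) : ℝ)
  | (w : ℝ) =>
      if (g 1 0 : ℝ) * w + (g 1 1 : ℝ) = 0 then OnePoint.infty
      else (((g 0 0 : ℝ) * w + (g 0 1 : ℝ)) / ((g 1 0 : ℝ) * w + (g 1 1 : ℝ)) : ℝ)

/-- The denominators of digits that are positive from index `1` on are positive. -/
theorem qq_succ_pos {a : ℕ → ℤ} (ha : ∀ k, 1 ≤ k → 0 < a k) (k : ℕ) :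
    0 < qq a (k + 1) ∧ 0 ≤ qq a k := by
  induction k with
  | zero => simp [qq]
  | succ k ih =>
    refine ⟨?_, ih.1.le⟩
    have h := mul_pos (ha (k + 1) (by omega)) ih.1
    simp only [qq]
    linarith [ih.2]

theorem sign_succ_eq_neg {x : ℕ → ℤ} {k : ℕ} (h : x k * x (k + 1) < 0) :
    (x (k + 1)).sign = -(x k).sign := by
  rcases mul_neg_iff.mp h with ⟨h₁, h₂⟩ | ⟨h₁, h₂⟩
  · rw [Int.sign_eq_one_of_pos h₁, Int.sign_eq_neg_one_of_neg h₂]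
  · rw [Int.sign_eq_one_of_pos h₂, Int.sign_eq_neg_one_of_neg h₁, neg_neg]

theorem sign_mul_self_of_ne_zero {n : ℤ} (h : n ≠ 0) : n.sign * n.sign = 1 := by
  rcases lt_or_gt_of_ne h with h | h
  · simp [Int.sign_eq_neg_one_of_neg h]
  · simp [Int.sign_eq_one_of_pos h]

/-- For an alternating sequence, the columns of `S T^{x₁} ⋯ S T^{x_k}` are, up to sign, the vectors
`(-ε p_{k-1}, q_{k-1})` and `(-ε p_k, q_k)`. -/
theorem prod_Smat_mul_Tpow_eq (x : ℕ → ℤ) (hx : ∀ k, 1 ≤ k → x k ≠ 0)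
    (halt : ∀ k, 1 ≤ k → x k * x (k + 1) < 0) (k : ℕ) :
    ∃ s t : ℤ, s * s = 1 ∧ t = -(x (k + 1)).sign * s ∧
      ((List.range k).map (fun j => Smat * Tpow (x (j + 1)))).prod =
        !![t * (-(x 1).sign * pp (fun j => |x j|) k),
            s * (-(x 1).sign * pp (fun j => |x j|) (k + 1));
          t * qq (fun j => |x j|) k, s * qq (fun j => |x j|) (k + 1)] := by
  induction k with
  | zero =>
    refine ⟨1, -(x 1).sign, by norm_num, by simp, ?_⟩
    simp [pp, qq, Matrix.one_fin_two, sign_mul_self_of_ne_zero (hx 1 le_rfl)]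
  | succ k ih =>
    obtain ⟨s, t, hs, ht, hM⟩ := ih
    have hsq := sign_mul_self_of_ne_zero (hx (k + 1) (by omega))
    have habs : x (k + 1) = (x (k + 1)).sign * |x (k + 1)| := (Int.sign_mul_abs _).symm
    refine ⟨(x (k + 1)).sign * s, s, by linear_combination s * s * hsq + hs, ?_, ?_⟩
    · rw [sign_succ_eq_neg (halt (k + 1) (by omega))]
      linear_combination -s * hsq
    · rw [List.range_succ, List.map_append, List.prod_append, hM]
      ext i j
      fin_cases i <;> fin_cases j <;>
        simp [Smat, Tpow, Matrix.mul_apply, Fin.sum_univ_two, pp, qq, ht]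
      · linear_combination (-s * (x 1).sign * pp (fun j => |x j|) (k + 1)) * habs
      · linear_combination (s * qq (fun j => |x j|) (k + 1)) * habs

/-- Rescaling the columns of a matrix with nonzero integers does not change the image of `∞`. -/
theorem mob_infty_of_mul {t a b c d : ℤ} (ht : t ≠ 0) (hc : c ≠ 0) :
    mob !![t * a, b; t * c, d] OnePoint.infty = (((a : ℝ) / c : ℝ) : OnePoint ℝ) := by
  have ht' : (t : ℝ) ≠ 0 := mod_cast ht
  have hc' : (c : ℝ) ≠ 0 := mod_cast hc
  simp [mob, ht', hc', mul_div_mul_left]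

/-- Rescaling the columns of a matrix with nonzero integers does not change the image of `0`. -/
theorem mob_zero_of_mul {s a b c d : ℤ} (hs : s ≠ 0) (hd : d ≠ 0) :
    mob !![a, s * b; c, s * d] ((0 : ℝ) : OnePoint ℝ) = (((b : ℝ) / d : ℝ) : OnePoint ℝ) := by
  have hs' : (s : ℝ) ≠ 0 := mod_cast hs
  have hd' : (d : ℝ) ≠ 0 := mod_cast hd
  change (if _ then _ else _) = _
  simp [hs', hd', mul_div_mul_left]

/-- Let `(x_k)_{k≥1}` be nonzero integers with `x_k x_{k+1} < 0`, `ε = sign x₁`, and let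
`p_j, q_j` be the convergents of the digits `a_j = |x_j|`.  Then for every `k ≥ 1` the
Möbius transformation of `ℝ ∪ {∞}` given by `S T^{x₁} ⋯ S T^{x_k}` maps `∞` to
`-ε p_{k-1}/q_{k-1}` and maps `0` to `-ε p_k/q_k`. -/
theorem statement2 (x : ℕ → ℤ) (hx : ∀ k, 1 ≤ k → x k ≠ 0)
    (halt : ∀ k, 1 ≤ k → x k * x (k + 1) < 0) (k : ℕ) (hk : 1 ≤ k) :
    mob (((List.range k).map (fun j => Smat * Tpow (x (j + 1)))).prod) OnePoint.infty
        = ((-(Int.sign (x 1) : ℝ) * (pp (fun j => |x j|) k : ℝ) /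
            (qq (fun j => |x j|) k : ℝ) : ℝ) : OnePoint ℝ) ∧
    mob (((List.range k).map (fun j => Smat * Tpow (x (j + 1)))).prod) ((0 : ℝ) : OnePoint ℝ)
        = ((-(Int.sign (x 1) : ℝ) * (pp (fun j => |x j|) (k + 1) : ℝ) /
            (qq (fun j => |x j|) (k + 1) : ℝ) : ℝ) : OnePoint ℝ) := by
  obtain ⟨s, t, hs, ht, hM⟩ := prod_Smat_mul_Tpow_eq x hx halt k
  have ha : ∀ k, 1 ≤ k → 0 < |x k| := fun k hk => abs_pos.mpr (hx k hk)
  have hs₀ : s ≠ 0 := left_ne_zero_of_mul_eq_one hs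
  have ht₀ : t ≠ 0 := by
    rw [ht]
    exact mul_ne_zero (neg_ne_zero.mpr (mt Int.sign_eq_zero_iff_zero.mp (hx _ (by omega)))) hs₀
  obtain ⟨m, rfl⟩ := Nat.exists_eq_add_of_le' hk
  rw [hM, mob_infty_of_mul ht₀ (qq_succ_pos ha m).1.ne',
    mob_zero_of_mul hs₀ (qq_succ_pos ha (m + 1)).1.ne']
  push_cast
  exact ⟨rfl, rfl⟩
end

section
/- The Gauss measure μ on [0,1], defined by μ(A) = (1/log 2) ∫_A dx/(1+x) (absolutely continuous with respect to Lebesgue measure with density 1/((log 2)(1+x))), is a probability measure, and the Gauss map T : [0,1] → [0,1], T(0) = 0 and T(x) = 1/x − ⌊1/x⌋ for x ≠ 0, is measure-preserving with respect to μ. -/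
open MeasureTheory

/-- The Gauss map `T : [0,1] → [0,1]`, `T 0 = 0` and `T x = 1/x - ⌊1/x⌋` for `x ≠ 0`. -/
noncomputable def gaussMap (x : ℝ) : ℝ :=
  if x = 0 then 0 else 1 / x - (⌊1 / x⌋ : ℝ)

/-- The Gauss measure `μ(A) = (1/log 2) ∫_A dx/(1+x)` on `[0,1]`: the measure absolutely
continuous w.r.t. Lebesgue measure on `[0,1]` with density `1/((log 2)(1+x))`. -/
noncomputable def gaussMeasure : Measure ℝ :=
  (volume.restrict (Set.Icc (0 : ℝ) 1)).withDensity
    (fun x => ENNReal.ofReal (1 / (Real.log 2 * (1 + x))))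

lemma gaussMap_eq_fract (x : ℝ) : gaussMap x = Int.fract x⁻¹ := by
  unfold gaussMap
  split_ifs with h
  · simp [h]
  · rw [one_div, Int.self_sub_floor]

lemma measurable_gaussMap : Measurable gaussMap := by
  rw [funext gaussMap_eq_fract]
  exact measurable_fract.comp measurable_inv

lemma gaussMeasure_Icc {a b : ℝ} (ha : 0 ≤ a) (hab : a ≤ b) (hb : b ≤ 1) :
    gaussMeasure (Set.Icc a b) =
      ENNReal.ofReal ((Real.log (1 + b) - Real.log (1 + a)) / Real.log 2) := by
  have hlog : 0 < Real.log 2 := Real.log_pos one_lt_two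
  have hcont : ContinuousOn (fun x : ℝ => 1 / (Real.log 2 * (1 + x))) (Set.Icc a b) := by
    refine continuousOn_const.div (by fun_prop) fun x hx => ?_
    have : 0 < 1 + x := by linarith [hx.1]
    positivity
  have hint : ∫ x in a..b, 1 / (Real.log 2 * (1 + x)) =
      (Real.log (1 + b) - Real.log (1 + a)) / Real.log 2 := by
    rw [sub_div]
    refine intervalIntegral.integral_eq_sub_of_hasDerivAt
      (f := fun x => Real.log (1 + x) / Real.log 2) (fun x hx => ?_) ?_
    · rw [Set.uIcc_of_le hab] at hx
      have hx0 : 1 + x ≠ 0 := by linarith [hx.1]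
      have h := (((hasDerivAt_id x).const_add 1).log hx0).div_const (Real.log 2)
      rw [id, div_div, mul_comm] at h
      exact h
    · rw [← Set.uIcc_of_le hab] at hcont
      exact hcont.intervalIntegrable
  rw [gaussMeasure, withDensity_apply _ measurableSet_Icc,
    Measure.restrict_restrict measurableSet_Icc,
    Set.inter_eq_left.2 (Set.Icc_subset_Icc ha hb), ← hint,
    intervalIntegral.integral_of_le hab, ← integral_Icc_eq_integral_Ioc,
    ofReal_integral_eq_lintegral_ofReal (hcont.integrableOn_Icc)]
  refine (ae_restrict_mem measurableSet_Icc).mono fun x hx => ?_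
  have : 0 < 1 + x := by linarith [hx.1]
  simp only [Pi.zero_apply]
  positivity

lemma ae_mem_Ioc_gaussMeasure : ∀ᵐ x ∂gaussMeasure, x ∈ Set.Ioc (0 : ℝ) 1 := by
  refine (withDensity_absolutelyContinuous _ _).ae_le ?_
  rw [← restrict_Ioc_eq_restrict_Icc]
  exact ae_restrict_mem measurableSet_Ioc

instance isProbabilityMeasure_gaussMeasure : IsProbabilityMeasure gaussMeasure := by
  refine ⟨?_⟩
  have h : (Set.univ : Set ℝ) =ᵐ[gaussMeasure] Set.Icc 0 1 := by
    filter_upwards [ae_mem_Ioc_gaussMeasure] with x hx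
    exact propext ⟨fun _ => ⟨hx.1.le, hx.2⟩, fun _ => trivial⟩
  rw [measure_congr h, gaussMeasure_Icc le_rfl zero_le_one le_rfl]
  have hlog : Real.log 2 ≠ 0 := (Real.log_pos one_lt_two).ne'
  norm_num [hlog]

lemma mem_Icc_one_div_iff {a m x : ℝ} (ha : 0 ≤ a) (hm : 0 < m) (hx : 0 < x) :
    x ∈ Set.Icc (1 / (m + a)) (1 / m) ↔ m ≤ x⁻¹ ∧ x⁻¹ ≤ m + a := by
  rw [Set.mem_Icc, one_div, one_div, inv_le_comm₀ (by positivity) hx, le_inv_comm₀ hx hm, and_comm]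

lemma floor_inv_eq_of_mem_Icc {a x : ℝ} (ha : 0 ≤ a) (ha1 : a < 1) {n : ℕ}
    (hx : x ∈ Set.Icc (1 / ((n : ℝ) + 1 + a)) (1 / ((n : ℝ) + 1))) : ⌊x⁻¹⌋ = (n : ℤ) + 1 := by
  have hx0 : 0 < x := lt_of_lt_of_le (by positivity) hx.1
  rw [mem_Icc_one_div_iff ha (by positivity) hx0] at hx
  rw [Int.floor_eq_iff]
  push_cast
  exact ⟨hx.1, by linarith⟩

lemma gaussMap_preimage_Iic_inter_Ioc {a : ℝ} (ha : 0 ≤ a) (ha1 : a < 1) :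
    gaussMap ⁻¹' Set.Iic a ∩ Set.Ioc 0 1 =
      ⋃ n : ℕ, Set.Icc (1 / ((n : ℝ) + 1 + a)) (1 / ((n : ℝ) + 1)) := by
  ext x
  simp only [Set.mem_inter_iff, Set.mem_preimage, Set.mem_Iic, Set.mem_iUnion, gaussMap_eq_fract]
  constructor
  · rintro ⟨hxa, hx⟩
    have h1 : 1 ≤ ⌊x⁻¹⌋ := Int.le_floor.2 (by simpa using (one_le_inv₀ hx.1).2 hx.2)
    obtain ⟨n, hn⟩ := Int.eq_ofNat_of_zero_le (sub_nonneg.2 h1)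
    have hn' : (⌊x⁻¹⌋ : ℝ) = n + 1 := by
      have : ⌊x⁻¹⌋ = (n : ℤ) + 1 := by omega
      exact_mod_cast this
    refine ⟨n, (mem_Icc_one_div_iff ha (by positivity) hx.1).2 ⟨hn' ▸ Int.floor_le _, ?_⟩⟩
    have := Int.floor_add_fract x⁻¹
    linarith
  · rintro ⟨n, hn⟩
    have hx0 : 0 < x := lt_of_lt_of_le (by positivity) hn.1
    refine ⟨?_, hx0, hn.2.trans ?_⟩
    · rw [Int.fract, floor_inv_eq_of_mem_Icc ha ha1 hn]
      rw [mem_Icc_one_div_iff ha (by positivity) hx0] at hn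
      push_cast
      linarith [hn.2]
    · exact div_le_one_of_le₀ (by simp) (by positivity)

lemma log_one_add_one_div_le {a : ℝ} (ha : 0 ≤ a) (n : ℕ) :
    Real.log (1 + 1 / ((n : ℝ) + 1 + a)) ≤ Real.log (1 + 1 / ((n : ℝ) + 1)) := by
  have h := one_div_le_one_div_of_le (by positivity : (0 : ℝ) < n + 1)
    (by linarith : (n : ℝ) + 1 ≤ n + 1 + a)
  exact Real.log_le_log (by positivity) (by linarith)

lemma hasSum_log_gauss {a : ℝ} (ha : 0 ≤ a) :
    HasSum (fun n : ℕ => Real.log (1 + 1 / ((n : ℝ) + 1)) - Real.log (1 + 1 / ((n : ℝ) + 1 + a)))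
      (Real.log (1 + a)) := by
  rw [hasSum_iff_tendsto_nat_of_nonneg]
  · have hsum : ∀ N : ℕ, ∑ n ∈ Finset.range N,
        (Real.log (1 + 1 / ((n : ℝ) + 1)) - Real.log (1 + 1 / ((n : ℝ) + 1 + a))) =
        Real.log (1 + a) - Real.log (1 + a / ((N : ℝ) + 1)) := by
      intro N
      have key : ∀ n : ℕ,
          Real.log (1 + 1 / ((n : ℝ) + 1)) - Real.log (1 + 1 / ((n : ℝ) + 1 + a)) =
          -Real.log (1 + a / ((n + 1 : ℕ) + 1 : ℝ)) - -Real.log (1 + a / ((n : ℝ) + 1)) := by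
        intro n
        rw [neg_sub_neg, ← Real.log_div (by positivity) (by positivity),
          ← Real.log_div (by positivity) (by positivity)]
        congr 1
        push_cast
        field_simp
        ring
      rw [Finset.sum_congr rfl fun n _ => key n,
        Finset.sum_range_sub fun n : ℕ => -Real.log (1 + a / ((n : ℝ) + 1))]
      simp
      ring
    simp_rw [hsum]
    have h0 : Filter.Tendsto (fun N : ℕ => 1 + a / ((N : ℝ) + 1)) Filter.atTop (nhds 1) := by
      simpa [div_eq_mul_inv] using
        (tendsto_one_div_add_atTop_nhds_zero_nat.const_mul a).const_add (1 : ℝ)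
    simpa using (h0.log one_ne_zero).const_sub (Real.log (1 + a))
  · exact fun n => sub_nonneg.2 (log_one_add_one_div_le ha n)

lemma gaussMeasure_preimage_Iic {a : ℝ} (ha : 0 ≤ a) (ha1 : a < 1) :
    gaussMeasure (gaussMap ⁻¹' Set.Iic a) =
      ENNReal.ofReal (Real.log (1 + a) / Real.log 2) := by
  have hlog : 0 < Real.log 2 := Real.log_pos one_lt_two
  have h : gaussMap ⁻¹' Set.Iic a =ᵐ[gaussMeasure]
      (gaussMap ⁻¹' Set.Iic a ∩ Set.Ioc 0 1 : Set ℝ) := by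
    filter_upwards [ae_mem_Ioc_gaussMeasure] with x hx
    exact propext ⟨fun h => ⟨h, hx⟩, fun h => h.1⟩
  rw [measure_congr h, gaussMap_preimage_Iic_inter_Ioc ha ha1,
    measure_iUnion ?_ fun _ => measurableSet_Icc]
  · have hs := (hasSum_log_gauss ha).div_const (Real.log 2)
    rw [← hs.tsum_eq, ENNReal.ofReal_tsum_of_nonneg ?_ hs.summable]
    · congr 1
      ext n
      refine gaussMeasure_Icc (by positivity) (one_div_le_one_div_of_le (by positivity) (by linarith))
        (div_le_one_of_le₀ (by simp) (by positivity))
    · exact fun n => div_nonneg (sub_nonneg.2 (log_one_add_one_div_le ha n)) hlog.le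
  · intro m n hmn
    refine Set.disjoint_left.2 fun x hm hn => hmn ?_
    have := (floor_inv_eq_of_mem_Icc ha ha1 hm).symm.trans (floor_inv_eq_of_mem_Icc ha ha1 hn)
    omega

lemma gaussMeasure_Iic {a : ℝ} (ha : 0 ≤ a) (ha1 : a ≤ 1) :
    gaussMeasure (Set.Iic a) = ENNReal.ofReal (Real.log (1 + a) / Real.log 2) := by
  have h : Set.Iic a =ᵐ[gaussMeasure] Set.Icc 0 a := by
    filter_upwards [ae_mem_Ioc_gaussMeasure] with x hx
    exact propext ⟨fun h => ⟨hx.1.le, h⟩, fun h => h.2⟩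
  rw [measure_congr h, gaussMeasure_Icc le_rfl ha ha1]
  simp

/-- The Gauss measure is a probability measure and the Gauss map is measure-preserving
with respect to it. -/
theorem statement5 :
    IsProbabilityMeasure gaussMeasure ∧
    MeasurePreserving gaussMap gaussMeasure gaussMeasure := by
  refine ⟨inferInstance, measurable_gaussMap, ?_⟩
  have : IsProbabilityMeasure (gaussMeasure.map gaussMap) :=
    Measure.isProbabilityMeasure_map measurable_gaussMap.aemeasurable
  refine Measure.ext_of_Iic _ _ fun a => ?_
  rw [Measure.map_apply measurable_gaussMap measurableSet_Iic]
  rcases lt_or_ge a 0 with ha | ha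
  · refine measure_congr ?_
    filter_upwards [ae_mem_Ioc_gaussMeasure] with x hx
    refine propext ⟨fun h => ?_, fun h => ?_⟩
    · have h' : gaussMap x ≤ a := h
      rw [gaussMap_eq_fract] at h'
      linarith [Int.fract_nonneg x⁻¹]
    · have h' : x ≤ a := h
      linarith [hx.1]
  rcases lt_or_ge a 1 with ha1 | ha1
  · rw [gaussMeasure_preimage_Iic ha ha1, gaussMeasure_Iic ha ha1.le]
  · refine measure_congr ?_
    filter_upwards [ae_mem_Ioc_gaussMeasure] with x hx
    refine propext ⟨fun _ => hx.2.trans ha1, fun _ => ?_⟩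
    change gaussMap x ≤ a
    rw [gaussMap_eq_fract]
    exact (Int.fract_lt_one _).le.trans ha1
end

section
/- Let β ∈ (0,1) be irrational with continued fraction digits a₁, a₂, … and convergent denominators q_n. Let (c_n)_{n≥1} be a bounded sequence of real numbers such that the limit α = lim_{n→∞} (c₁ + c₂ + ⋯ + c_n)/(2 log q_n) exists and α ≠ 0. Then lim_{n→∞} (log a_{n+1})/(log q_n) = 0. -/
open Filter

/-- The `n`-th continued fraction digit of `β` (for `n ≥ 1`): `a_n(β) = ⌊1/(T^{n-1} β)⌋`. -/
noncomputable def digit (β : ℝ) (n : ℕ) : ℤ :=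
  ⌊1 / (gaussMap^[n - 1] β)⌋

/-- `qDen β (n+1) = q_n(β)`, the denominator of the `n`-th convergent of `β`. -/
noncomputable def qDen (β : ℝ) : ℕ → ℤ := qq (digit β)

theorem gaussMap_irrational {x : ℝ} (hx : Irrational x) : Irrational (gaussMap x) := by
  rw [gaussMap, if_neg hx.ne_zero, one_div]
  exact (irrational_inv_iff.mpr hx).sub_intCast _

theorem gaussMap_mem_Ioo {x : ℝ} (hx : Irrational x) : gaussMap x ∈ Set.Ioo (0 : ℝ) 1 := by
  have hirr := gaussMap_irrational hx
  have hfract : gaussMap x = Int.fract (1 / x) := by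
    rw [gaussMap, if_neg hx.ne_zero, Int.fract]
  refine ⟨lt_of_le_of_ne ?_ hirr.ne_zero.symm, ?_⟩ <;> rw [hfract]
  · exact Int.fract_nonneg _
  · exact Int.fract_lt_one _

theorem iterate_gaussMap_mem {β : ℝ} (hβ : β ∈ Set.Ioo (0 : ℝ) 1) (hirr : Irrational β) (n : ℕ) :
    Irrational (gaussMap^[n] β) ∧ gaussMap^[n] β ∈ Set.Ioo (0 : ℝ) 1 := by
  induction n with
  | zero => exact ⟨hirr, hβ⟩
  | succ n ih =>
    rw [Function.iterate_succ_apply']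
    exact ⟨gaussMap_irrational ih.1, gaussMap_mem_Ioo ih.1⟩

theorem one_le_digit {β : ℝ} (hβ : β ∈ Set.Ioo (0 : ℝ) 1) (hirr : Irrational β) (n : ℕ) :
    1 ≤ digit β n := by
  obtain ⟨-, h0, h1⟩ := iterate_gaussMap_mem hβ hirr (n - 1)
  rw [digit, Int.le_floor, Int.cast_one, one_div]
  exact (one_le_inv₀ h0).mpr h1.le

theorem qq_nonneg_and_pos {a : ℕ → ℤ} (ha : ∀ n, 1 ≤ a n) (k : ℕ) :
    0 ≤ qq a k ∧ 0 < qq a (k + 1) := by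
  induction k with
  | zero => simp [qq]
  | succ k ih =>
    refine ⟨ih.2.le, ?_⟩
    rw [qq]
    nlinarith [ha (k + 1)]

theorem qq_add_le {a : ℕ → ℤ} (ha : ∀ n, 1 ≤ a n) (k : ℕ) :
    qq a (k + 1) + qq a k ≤ qq a (k + 2) := by
  rw [qq]
  nlinarith [ha (k + 1), (qq_nonneg_and_pos ha k).2]

theorem natCast_le_qq {a : ℕ → ℤ} (ha : ∀ n, 1 ≤ a n) (k : ℕ) : (k : ℤ) ≤ qq a (k + 1) := by
  induction k with
  | zero => exact (qq_nonneg_and_pos ha 0).2.le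
  | succ k ih =>
    have hadd := qq_add_le ha k
    cases k with
    | zero => exact (qq_nonneg_and_pos ha 1).2
    | succ k =>
      have hpos := (qq_nonneg_and_pos ha k).2
      simp only [Nat.add_assoc, Nat.reduceAdd] at *
      push_cast at *
      omega

theorem tendsto_log_qq {a : ℕ → ℤ} (ha : ∀ n, 1 ≤ a n) :
    Tendsto (fun n : ℕ => Real.log (qq a (n + 1))) atTop atTop := by
  refine Real.tendsto_log_atTop.comp (tendsto_atTop_mono (fun n => ?_) tendsto_natCast_atTop_atTop)
  exact_mod_cast natCast_le_qq ha n

theorem log_digit_add_log_qq_le {a : ℕ → ℤ} (ha : ∀ n, 1 ≤ a n) (n : ℕ) :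
    Real.log (a (n + 1)) + Real.log (qq a (n + 1)) ≤ Real.log (qq a (n + 2)) := by
  have h1 : (0 : ℝ) < a (n + 1) := by exact_mod_cast (ha (n + 1))
  have h2 : (0 : ℝ) < qq a (n + 1) := by exact_mod_cast (qq_nonneg_and_pos ha n).2
  rw [← Real.log_mul h1.ne' h2.ne']
  refine Real.log_le_log (mul_pos h1 h2) ?_
  have : a (n + 1) * qq a (n + 1) ≤ qq a (n + 2) := by
    rw [qq]
    linarith [(qq_nonneg_and_pos ha n).1]
  exact_mod_cast this

/-- If the increments of `S` are bounded, `L → ∞`, and `S / (2 L)` has a nonzero limit, then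
consecutive terms of `L` are asymptotically equal. -/
theorem tendsto_succ_div_of_tendsto_sum_div {c L : ℕ → ℝ} {C α : ℝ}
    (hc : ∀ n, 1 ≤ n → |c n| ≤ C) (hα : α ≠ 0) (hL : Tendsto L atTop atTop)
    (hlim : Tendsto (fun n => (∑ k ∈ Finset.Icc 1 n, c k) / (2 * L n)) atTop (nhds α)) :
    Tendsto (fun n => L (n + 1) / L n) atTop (nhds 1) := by
  have hsucc := (tendsto_add_atTop_iff_nat 1).mpr hlim
  have hinc : Tendsto (fun n => c (n + 1) / (2 * L n)) atTop (nhds 0) :=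
    tendsto_bdd_div_atTop_nhds_zero
      (Eventually.of_forall fun n => (abs_le.mp (hc (n + 1) n.succ_pos)).1)
      (Eventually.of_forall fun n => (abs_le.mp (hc (n + 1) n.succ_pos)).2)
      (hL.const_mul_atTop two_pos)
  have hquot := (hlim.add hinc).div hsucc hα
  rw [add_zero, div_self hα] at hquot
  refine hquot.congr' ?_
  filter_upwards [hsucc.eventually_ne hα, hL.eventually_gt_atTop 0,
    ((tendsto_add_atTop_iff_nat 1).mpr hL).eventually_gt_atTop 0] with n hS h0 h1
  have hS' : ∑ k ∈ Finset.Icc 1 (n + 1), c k ≠ 0 := fun h => hS (by rw [h, zero_div])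
  simp only [Pi.div_apply]
  rw [← add_div, ← Finset.sum_Icc_succ_top (by omega)]
  field_simp

/-- Let `β ∈ (0,1)` be irrational with digits `a_n` and convergent denominators `q_n`,
and let `(c_n)_{n≥1}` be a bounded real sequence such that
`α = lim (c₁ + ⋯ + c_n)/(2 log q_n)` exists and `α ≠ 0`.  Then
`lim (log a_{n+1})/(log q_n) = 0`. -/
theorem statement9 (β : ℝ) (hβ : β ∈ Set.Ioo (0 : ℝ) 1) (hirr : Irrational β)
    (c : ℕ → ℝ) (hc : ∃ C : ℝ, ∀ n, 1 ≤ n → |c n| ≤ C) (α : ℝ) (hα : α ≠ 0)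
    (hlim : Tendsto
      (fun n : ℕ => (∑ k ∈ Finset.Icc 1 n, c k) / (2 * Real.log (qDen β (n + 1))))
      atTop (nhds α)) :
    Tendsto (fun n : ℕ => Real.log (digit β (n + 1)) / Real.log (qDen β (n + 1)))
      atTop (nhds 0) := by
  obtain ⟨C, hC⟩ := hc
  have ha := one_le_digit hβ hirr
  have hL : Tendsto (fun n : ℕ => Real.log (qDen β (n + 1))) atTop atTop := tendsto_log_qq ha
  have hratio := (tendsto_succ_div_of_tendsto_sum_div hC hα hL hlim).sub_const 1
  rw [sub_self] at hratio
  refine tendsto_of_tendsto_of_tendsto_of_le_of_le' tendsto_const_nhds hratio ?_ ?_ <;>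
    filter_upwards [hL.eventually_gt_atTop 0] with n hn
  · exact div_nonneg (Real.log_nonneg (by exact_mod_cast ha (n + 1))) hn.le
  · rw [div_sub_one hn.ne']
    gcongr
    exact le_sub_iff_add_le.mpr (log_digit_add_log_qq_le ha n)
end

section
/- Let G be a finite-index subgroup of PSL₂(ℤ), let E_G ⊂ PSL₂(ℤ) be a set of representatives of the right cosets G\PSL₂(ℤ) (one representative per coset), and for each nonzero integer x let τ_x : E_G → E_G be the map sending e to the unique element of E_G lying in the coset G · (e S T^x). Consider the alphabet A = (ℤ∖{0}) × E_G and call a finite or infinite word ((x₁,e₁),(x₂,e₂),…) over A admissible if x_k x_{k+1} < 0 and e_{k+1} = τ_{x_k}(e_k) for all consecutive indices k. Then this subshift is finitely irreducible: there exists a finite set W of finite admissible words such that for every pair of letters a, b ∈ A there is w ∈ W for which the concatenation a w b is admissible. -/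
open Matrix MatrixGroups

/-- The image of `S = [[0,-1],[1,0]]` in `PSL₂(ℤ)`. -/
def Sbar : PSL(2, ℤ) := QuotientGroup.mk ModularGroup.S

/-- The image of `T = [[1,1],[0,1]]` in `PSL₂(ℤ)`. -/
def Tbar : PSL(2, ℤ) := QuotientGroup.mk ModularGroup.T

/-- A finite word over the alphabet `(ℤ∖{0}) × E_G` is admissible if every letter `(x, e)`
has `x ≠ 0` and `e ∈ E`, and consecutive letters `(x_k, e_k), (x_{k+1}, e_{k+1})` satisfy
`x_k x_{k+1} < 0` and `e_{k+1} = τ_{x_k}(e_k)`. -/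
def Admissible (E : Set PSL(2, ℤ)) (τ : ℤ → PSL(2, ℤ) → PSL(2, ℤ))
    (w : List (ℤ × PSL(2, ℤ))) : Prop :=
  (∀ p ∈ w, p.1 ≠ 0 ∧ p.2 ∈ E) ∧
  w.Chain' (fun p q => p.1 * q.1 < 0 ∧ q.2 = τ p.1 p.2)

theorem Admissible.middle {E : Set PSL(2, ℤ)} {τ : ℤ → PSL(2, ℤ) → PSL(2, ℤ)}
    {a b : ℤ × PSL(2, ℤ)} {w : List (ℤ × PSL(2, ℤ))} (h : Admissible E τ (a :: (w ++ [b]))) :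
    Admissible E τ w :=
  ⟨fun p hp => h.1 p (by simp [hp]), (List.IsChain.tail h.2).left_of_append⟩

theorem Sbar_pow_four : Sbar ^ 4 = 1 := by
  have h : ModularGroup.S ^ 4 = 1 := by decide
  exact (QuotientGroup.mk_pow _ _ _).symm.trans (congrArg QuotientGroup.mk h)

theorem Sbar_mul_Tbar_pow_three : (Sbar * Tbar) ^ 3 = Sbar ^ 2 := by
  have h : (ModularGroup.S * ModularGroup.T) ^ 3 = ModularGroup.S ^ 2 := by decide
  exact congrArg (QuotientGroup.mk (s := Subgroup.center SL(2, ℤ))) h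

theorem closure_Sbar_Tbar : Subgroup.closure {Sbar, Tbar} = (⊤ : Subgroup PSL(2, ℤ)) := by
  have h := congrArg (Subgroup.map (QuotientGroup.mk' (Subgroup.center SL(2, ℤ))))
    SpecialLinearGroup.SL2Z_generators
  rw [MonoidHom.map_closure, Set.image_pair,
    Subgroup.map_top_of_surjective _ (QuotientGroup.mk'_surjective _)] at h
  exact h

/-- The transitions of the subshift, recorded on pairs consisting of the sign and the coset
representative of the next letter. -/
def SignStep (E : Set PSL(2, ℤ)) (τ : ℤ → PSL(2, ℤ) → PSL(2, ℤ)) (p q : ℤˣ × PSL(2, ℤ)) : Prop :=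
  p.2 ∈ E ∧ ∃ x : ℤ, 0 < x * p.1 ∧ q = (-p.1, τ x p.2)

/-- A path of transitions is spelled by a word that can be inserted between any two letters
compatible with its endpoints. -/
theorem exists_word_of_reflTransGen {E : Set PSL(2, ℤ)} {τ : ℤ → PSL(2, ℤ) → PSL(2, ℤ)}
    {p q : ℤˣ × PSL(2, ℤ)} (h : Relation.ReflTransGen (SignStep E τ) p q) :
    ∃ w : List (ℤ × PSL(2, ℤ)), ∀ a b : ℤ × PSL(2, ℤ), a.1 * p.1 < 0 → a.2 ∈ E →
      τ a.1 a.2 = p.2 → 0 < b.1 * q.1 → b.2 ∈ E → b.2 = q.2 →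
      Admissible E τ (a :: (w ++ [b])) := by
  induction h using Relation.ReflTransGen.head_induction_on with
  | refl =>
    refine ⟨[], fun a b ha haE hap hb hbE hbq => ⟨?_, ?_⟩⟩
    · intro c hc
      simp only [List.nil_append, List.mem_cons, List.not_mem_nil, or_false] at hc
      rcases hc with rfl | rfl
      · exact ⟨left_ne_zero_of_mul ha.ne, haE⟩
      · exact ⟨left_ne_zero_of_mul hb.ne', hbE⟩
    · refine List.IsChain.cons_cons ⟨?_, hbq.trans hap.symm⟩ (List.IsChain.singleton _)
      rcases Int.units_eq_one_or q.1 with h | h <;> rw [h] at ha hb <;>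
        simp only [Units.val_one, Units.val_neg] at ha hb <;> nlinarith
  | @head p r hpr _ ih =>
    obtain ⟨w, hw⟩ := ih
    obtain ⟨hpE, x, hx, rfl⟩ := hpr
    refine ⟨(x, p.2) :: w, fun a b ha haE hap hb hbE hbq => ?_⟩
    have key := hw (x, p.2) b (by simpa using hx) hpE rfl hb hbE hbq
    refine ⟨?_, ?_⟩
    · intro c hc
      rcases List.mem_cons.1 hc with rfl | hc
      · exact ⟨left_ne_zero_of_mul ha.ne, haE⟩
      · exact key.1 c hc
    · refine List.IsChain.cons_cons ⟨?_, hap.symm⟩ key.2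
      rcases Int.units_eq_one_or p.1 with h | h <;> rw [h] at ha hx <;>
        simp only [Units.val_one, Units.val_neg] at ha hx <;> nlinarith

/-- Right multiplication by `m` is realised, modulo `G`, by a path of transitions from
sign `s` to sign `s'`. -/
def Realizes (G : Subgroup PSL(2, ℤ)) (E : Set PSL(2, ℤ)) (τ : ℤ → PSL(2, ℤ) → PSL(2, ℤ))
    (s s' : ℤˣ) (m : PSL(2, ℤ)) : Prop :=
  ∀ c ∈ E, ∀ c' ∈ E, (∃ g ∈ G, c' = g * (c * m)) →
    Relation.ReflTransGen (SignStep E τ) (s, c) (s', c')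

section Realizes

variable {G : Subgroup PSL(2, ℤ)} {E : Set PSL(2, ℤ)} {τ : ℤ → PSL(2, ℤ) → PSL(2, ℤ)}

theorem eq_of_mem_coset (hE : ∀ h : PSL(2, ℤ), ∃! e, e ∈ E ∧ ∃ g ∈ G, h = g * e)
    {c c' : PSL(2, ℤ)} (hc : c ∈ E) (hc' : c' ∈ E) (h : ∃ g ∈ G, c' = g * c) : c' = c :=
  (hE c').unique ⟨hc', 1, G.one_mem, (one_mul _).symm⟩ ⟨hc, h⟩

theorem finite_transversal [G.FiniteIndex]
    (hE : ∀ h : PSL(2, ℤ), ∃! e, e ∈ E ∧ ∃ g ∈ G, h = g * e) : E.Finite := by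
  refine Set.Finite.of_finite_image
    (Set.toFinite ((fun e : PSL(2, ℤ) => (QuotientGroup.mk e⁻¹ : PSL(2, ℤ) ⧸ G)) '' E)) ?_
  intro c hc c' hc' h
  refine eq_of_mem_coset hE hc' hc ⟨c * c'⁻¹, ?_, by group⟩
  simpa using QuotientGroup.eq.1 h

theorem Realizes.mul (hE : ∀ h : PSL(2, ℤ), ∃! e, e ∈ E ∧ ∃ g ∈ G, h = g * e)
    {s s' s'' : ℤˣ} {m m' : PSL(2, ℤ)} (h : Realizes G E τ s s' m)
    (h' : Realizes G E τ s' s'' m') : Realizes G E τ s s'' (m * m') := by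
  rintro c hc c'' hc'' ⟨g, hg, rfl⟩
  obtain ⟨c', ⟨hc', k, hk, hck⟩, -⟩ := hE (c * m)
  refine (h c hc c' hc' ⟨k⁻¹, G.inv_mem hk, by rw [hck]; group⟩).trans
    (h' c' hc' _ hc'' ⟨g * k, G.mul_mem hg hk, ?_⟩)
  rw [← mul_assoc c, hck]; group

theorem realizes_Sbar_mul_Tbar_zpow [G.FiniteIndex]
    (hE : ∀ h : PSL(2, ℤ), ∃! e, e ∈ E ∧ ∃ g ∈ G, h = g * e)
    (hτ : ∀ x : ℤ, x ≠ 0 → ∀ e ∈ E,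
      τ x e ∈ E ∧ ∃ g ∈ G, τ x e = g * (e * Sbar * Tbar ^ x))
    (s : ℤˣ) (k : ℤ) : Realizes G E τ s (-s) (Sbar * Tbar ^ k) := by
  rintro c hc c' hc' ⟨g, hg, hgc⟩
  obtain ⟨N, hN, hTN⟩ : ∃ N : ℕ, 0 < N ∧ Tbar ^ N ∈ G.normalCore :=
    ⟨G.normalCore.index, Nat.pos_of_ne_zero Subgroup.FiniteIndex.index_ne_zero,
      Subgroup.pow_index_mem _ _⟩
  obtain ⟨j, hj⟩ : ∃ j : ℤ, 0 < (N * j + k) * (s : ℤ) := by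
    refine ⟨s * (|k| + 1), ?_⟩
    have h1 : (1 : ℤ) ≤ N := by exact_mod_cast hN
    have h2 := neg_abs_le k
    have h3 := le_abs_self k
    rcases Int.units_eq_one_or s with rfl | rfl <;>
      simp only [Units.val_one, Units.val_neg] <;> nlinarith
  obtain ⟨hx, g', hg', hgx⟩ := hτ _ (left_ne_zero_of_mul hj.ne') c hc
  refine Relation.ReflTransGen.single ⟨hc, _, hj, Prod.ext rfl ?_⟩
  refine eq_of_mem_coset hE hx hc' ?_
  have hcore := G.normalCore_le
    (Subgroup.normalCore_normal G |>.conj_mem _ (G.normalCore.zpow_mem hTN j) (c * Sbar))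
  refine ⟨_, G.mul_mem (G.mul_mem hg (G.inv_mem hcore)) (G.inv_mem hg'), ?_⟩
  simp only [hgx, hgc, _root_.zpow_add, _root_.zpow_mul, zpow_natCast]
  group

theorem realizes_all [G.FiniteIndex]
    (hE : ∀ h : PSL(2, ℤ), ∃! e, e ∈ E ∧ ∃ g ∈ G, h = g * e)
    (hτ : ∀ x : ℤ, x ≠ 0 → ∀ e ∈ E,
      τ x e ∈ E ∧ ∃ g ∈ G, τ x e = g * (e * Sbar * Tbar ^ x))
    (s s' : ℤˣ) (m : PSL(2, ℤ)) : Realizes G E τ s s' m := by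
  have hST (s : ℤˣ) : Realizes G E τ s (-s) (Sbar * Tbar) := by
    simpa using realizes_Sbar_mul_Tbar_zpow hE hτ s 1
  have hS (s : ℤˣ) : Realizes G E τ s (-s) Sbar := by
    simpa using realizes_Sbar_mul_Tbar_zpow hE hτ s 0
  have hS2 (s : ℤˣ) : Realizes G E τ s s (Sbar ^ 2) := by
    simpa [pow_two] using (hS s).mul hE (hS (-s))
  have hS2' (s : ℤˣ) : Realizes G E τ s (-s) (Sbar ^ 2) := by
    rw [← Sbar_mul_Tbar_pow_three, pow_three']
    simpa using ((hST s).mul hE (hST (-s))).mul hE (hST (- -s))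
  have hone (s : ℤˣ) : Realizes G E τ s s 1 := by
    rw [← Sbar_pow_four, show 4 = 2 + 2 from rfl, pow_add]
    exact (hS2 s).mul hE (hS2 s)
  have hone' (s : ℤˣ) : Realizes G E τ s (-s) 1 := by
    rw [← Sbar_pow_four, show 4 = 2 + 2 from rfl, pow_add]
    exact (hS2 s).mul hE (hS2' s)
  have flip {s s' : ℤˣ} {m : PSL(2, ℤ)} (h : Realizes G E τ s s' m) (t : ℤˣ) :
      Realizes G E τ s t m := by
    have h1 : Realizes G E τ s' t 1 := by
      rcases eq_or_ne t s' with rfl | ht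
      · exact hone t
      · rw [Int.units_ne_iff_eq_neg.1 ht]; exact hone' s'
    simpa using h.mul hE h1
  have hSinv : Sbar ^ 2 * Sbar = Sbar⁻¹ :=
    eq_inv_of_mul_eq_one_left (by rw [mul_assoc, ← pow_two, ← pow_add, Sbar_pow_four])
  have hSi (s t : ℤˣ) : Realizes G E τ s t Sbar⁻¹ := by
    rw [← hSinv]
    exact flip ((hS2 s).mul hE (hS s)) t
  have hT (s t : ℤˣ) (k : ℤ) : Realizes G E τ s t (Tbar ^ k) := by
    simpa using flip ((hSi s s).mul hE (realizes_Sbar_mul_Tbar_zpow hE hτ s k)) t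
  have hm : m ∈ Subgroup.closure {Sbar, Tbar} := by rw [closure_Sbar_Tbar]; trivial
  induction hm using Subgroup.closure_induction'' generalizing s s' with
  | mem x hx =>
    rcases hx with rfl | rfl
    · exact flip (hS s) s'
    · simpa using hT s s' 1
  | inv_mem x hx =>
    rcases hx with rfl | rfl
    · exact hSi s s'
    · simpa using hT s s' (-1)
  | one => exact flip (hone s) s'
  | mul x y _ _ hx hy => exact (hx s s).mul hE (hy s s')

end Realizes

/-- Let `G ≤ PSL₂(ℤ)` have finite index, let `E` be a set of representatives of the right
cosets `G\PSL₂(ℤ)` (exactly one per coset), and for each nonzero `x` let `τ x` send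
`e ∈ E` to the unique element of `E` in the coset `G·(e S T^x)`.  Then the subshift of
admissible words over the alphabet `(ℤ∖{0}) × E` is finitely irreducible: there is a
finite set `W` of finite admissible words such that for all letters `a, b` of the
alphabet there is `w ∈ W` with `a w b` admissible. -/
theorem statement13 (G : Subgroup PSL(2, ℤ)) (hG : G.FiniteIndex)
    (E : Set PSL(2, ℤ))
    (hE : ∀ h : PSL(2, ℤ), ∃! e, e ∈ E ∧ ∃ g ∈ G, h = g * e)
    (τ : ℤ → PSL(2, ℤ) → PSL(2, ℤ))
    (hτ : ∀ x : ℤ, x ≠ 0 → ∀ e ∈ E,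
      τ x e ∈ E ∧ ∃ g ∈ G, τ x e = g * (e * Sbar * Tbar ^ x)) :
    ∃ W : Finset (List (ℤ × PSL(2, ℤ))),
      (∀ w ∈ W, Admissible E τ w) ∧
      ∀ a b : ℤ × PSL(2, ℤ), a.1 ≠ 0 → a.2 ∈ E → b.1 ≠ 0 → b.2 ∈ E →
        ∃ w ∈ W, Admissible E τ (a :: (w ++ [b])) := by
  classical
  have hfin : Finite E := finite_transversal hE
  have hword (i : (ℤˣ × E) × ℤˣ × E) := exists_word_of_reflTransGen
    (realizes_all hE hτ i.1.1 i.2.1 ((i.1.2 : PSL(2, ℤ))⁻¹ * i.2.2) i.1.2 i.1.2.2 i.2.2 i.2.2.2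
      ⟨1, G.one_mem, by group⟩)
  choose f hf using hword
  refine ⟨(Set.finite_range f).toFinset.filter (Admissible E τ),
    fun w hw => (Finset.mem_filter.1 hw).2, fun a b ha haE hb hbE => ?_⟩
  have hsign {x : ℤ} (hx : x ≠ 0) : ∃ s : ℤˣ, 0 < x * s := by
    rcases hx.lt_or_gt with h | h
    · exact ⟨-1, by simpa using h⟩
    · exact ⟨1, by simpa using h⟩
  obtain ⟨s, hs⟩ := hsign ha
  obtain ⟨t, ht⟩ := hsign hb
  have key := hf ((-s, ⟨τ a.1 a.2, (hτ a.1 ha a.2 haE).1⟩), t, ⟨b.2, hbE⟩) a b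
    (by simpa using hs) haE rfl ht hbE rfl
  exact ⟨_, Finset.mem_filter.2 ⟨by simp, key.middle⟩, key⟩
end
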